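/- arXiv:1604.05412 — 2 statements merged into one kernel-verified Lean document; each statement's English description precedes it below -/
import Mathlib

section
/- Let Δ be a strongly shellable simplicial complex. Then there exists a strong shelling order F₁, …, F_t on F(Δ) that is dimension-decreasing, i.e. dim(F₁) ≥ dim(F₂) ≥ ⋯ ≥ dim(F_t). -/
variable {α : Type*}

/-- A (nonempty) simplicial complex: a finite nonempty collection of finite sets
closed under taking subsets. -/
def IsComplex (Δ : Finset (Finset α)) : Prop :=
  Δ.Nonempty ∧ ∀ F ∈ Δ, ∀ G ⊆ F, G ∈ Δ

/-- A facet: a face maximal under inclusion. -/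
def IsFacet (Δ : Finset (Finset α)) (F : Finset α) : Prop :=
  F ∈ Δ ∧ ∀ G ∈ Δ, F ⊆ G → F = G

/-- `L` is a strong shelling order on the facet set of `Δ`: `L` enumerates the
facets without repetition, and for all `i < j` there is `k < j` with
`|F_j \ F_k| = 1`, `F_j \ F_k ⊆ F_j \ F_i` and `F_k \ F_j ⊆ F_i`. -/
def IsSSO [DecidableEq α] (Δ : Finset (Finset α)) (L : List (Finset α)) : Prop :=
  L.Nodup ∧ (∀ F, F ∈ L ↔ IsFacet Δ F) ∧
    ∀ i j : Fin L.length, i < j → ∃ k : Fin L.length, k < j ∧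
      (L.get j \ L.get k).card = 1 ∧
      L.get j \ L.get k ⊆ L.get j \ L.get i ∧
      L.get k \ L.get j ⊆ L.get i

/-- A complex is strongly shellable if its facet set admits a strong shelling order. -/
def StronglyShellable [DecidableEq α] (Δ : Finset (Finset α)) : Prop :=
  ∃ L, IsSSO Δ L

/-- `G` is a strong exchange of `F` towards `E`: it drops one vertex of `F` outside `E`
and gains only vertices of `E`. -/
def IsStrongExchange [DecidableEq α] (E F G : Finset α) : Prop :=
  (F \ G).card = 1 ∧ F \ G ⊆ F \ E ∧ G \ F ⊆ E

theorem IsStrongExchange.card_le [DecidableEq α] {Δ : Finset (Finset α)} {E F G : Finset α}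
    (hF : IsFacet Δ F) (hG : IsFacet Δ G) (h : IsStrongExchange E F G) : F.card ≤ G.card := by
  have hne : (G \ F).Nonempty := by
    rw [Finset.sdiff_nonempty]
    intro hsub
    have hcard := h.1
    simp [hG.2 F hF.1 hsub] at hcard
  have hcard := h.1
  have hpos := hne.card_pos
  have hFG := Finset.card_sdiff_add_card_inter F G
  have hGF := Finset.card_sdiff_add_card_inter G F
  rw [Finset.inter_comm] at hGF
  omega

/-- An exchange of `F` towards a set `E'` lying between `E` and `F` is an exchange
towards `E`. -/
theorem IsStrongExchange.of_exchange [DecidableEq α] {E E' F G : Finset α}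
    (h' : IsStrongExchange F E E') (h : IsStrongExchange E' F G) : IsStrongExchange E F G := by
  obtain ⟨-, h₁, h₂⟩ := h'
  obtain ⟨h₃, h₄, h₅⟩ := h
  refine ⟨h₃, fun x hx => ?_, fun x hx => ?_⟩
  · have a := @h₁ x
    have b := h₄ hx
    simp only [Finset.mem_sdiff] at *
    tauto
  · have a := @h₂ x
    have b := h₅ hx
    simp only [Finset.mem_sdiff] at *
    tauto

/-- In a strong shelling order, exchanges with earlier facets also exist towards later
facets of larger cardinality. -/
theorem IsSSO.exists_exchange [DecidableEq α] {Δ : Finset (Finset α)} {L : List (Finset α)}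
    (hL : IsSSO Δ L) (j : Fin L.length) (i : Fin L.length)
    (hij : i < j ∨ (L.get j).card < (L.get i).card) :
    ∃ k < j, IsStrongExchange (L.get i) (L.get j) (L.get k) := by
  induction i using WellFoundedLT.induction with
  | ind i ih =>
    rcases lt_trichotomy i j with h | rfl | h
    · exact hL.2.2 i j h
    · simp at hij
    · have hcard := hij.resolve_left h.not_gt
      obtain ⟨m, hm, hex⟩ := hL.2.2 j i h
      have hle := IsStrongExchange.card_le ((hL.2.1 _).1 (L.get_mem i))
        ((hL.2.1 _).1 (L.get_mem m)) hex
      obtain ⟨k, hk, hk'⟩ := ih m hm (Or.inr (hcard.trans_le hle))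
      exact ⟨k, hk, IsStrongExchange.of_exchange hex hk'⟩

/-- Positions of a list of finite sets, compared by decreasing cardinality and then by
position. -/
def CardPosLE (L : List (Finset α)) (a b : Fin L.length) : Prop :=
  (L.get b).card < (L.get a).card ∨ (L.get b).card = (L.get a).card ∧ a ≤ b

/-- a strongly shellable complex admits a dimension-decreasing strong
shelling order (consecutive facets have non-increasing cardinality, hence the whole
order is dimension-decreasing). -/
theorem stmt2 [DecidableEq α] (Δ : Finset (Finset α)) (hΔ : IsComplex Δ)
    (hss : StronglyShellable Δ) :
    ∃ L : List (Finset α), IsSSO Δ L ∧ L.Chain' (fun F G => G.card ≤ F.card) := by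
  classical
  obtain ⟨L, hL⟩ := hss
  have : Std.Total (CardPosLE L) := ⟨fun a b => by unfold CardPosLE; omega⟩
  have : IsTrans _ (CardPosLE L) := ⟨fun a b c => by unfold CardPosLE; omega⟩
  set S := (List.finRange L.length).insertionSort (CardPosLE L)
  have hsorted : S.Pairwise (CardPosLE L) := List.pairwise_insertionSort _ _
  have hperm : S.Perm (List.finRange L.length) := List.perm_insertionSort _ _
  have hmap : (S.map L.get).Perm L := by
    simpa only [List.map_get_finRange] using hperm.map L.get
  have hnodup : S.Nodup := hperm.nodup_iff.2 (List.nodup_finRange _)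
  refine ⟨S.map L.get, ⟨hmap.nodup_iff.2 hL.1, fun F => hmap.mem_iff.trans (hL.2.1 F), ?_⟩, ?_⟩
  · rintro ⟨i, hi⟩ ⟨j, hj⟩ hij
    rw [Fin.mk_lt_mk] at hij
    rw [List.length_map] at hi hj
    have hr : CardPosLE L S[i] S[j] := List.pairwise_iff_getElem.1 hsorted i j hi hj hij
    have hne : S[i] ≠ S[j] := fun h => hij.ne ((hnodup.getElem_inj_iff).1 h)
    obtain ⟨c, hc, hex⟩ := hL.exists_exchange S[j] S[i] <| by
      unfold CardPosLE at hr
      omega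
    have hle := IsStrongExchange.card_le ((hL.2.1 _).1 (L.get_mem _))
      ((hL.2.1 _).1 (L.get_mem _)) hex
    obtain ⟨k, hk, rfl⟩ := List.getElem_of_mem (hperm.mem_iff.2 (List.mem_finRange c))
    have hkj : k < j := by
      by_contra! hjk
      rcases hjk.eq_or_lt with rfl | hjk
      · exact lt_irrefl _ hc
      · have hr' : CardPosLE L S[j] S[k] := List.pairwise_iff_getElem.1 hsorted j k hj hk hjk
        unfold CardPosLE at hr'
        omega
    refine ⟨⟨k, by simpa using hk⟩, hkj, ?_⟩
    simpa [IsStrongExchange] using hex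
  · refine List.Pairwise.isChain (List.pairwise_map.2 (hsorted.imp fun {a b} h => ?_))
    exact h.elim le_of_lt fun h => h.1.le
end

section
/- Every pure shifted simplicial complex on [n] is strongly shellable. That is, if Δ is a pure simplicial complex on [n] = {1, …, n} such that for every face F ∈ Δ, every i ∈ F and every j ∈ [n] with j > i, one has (F ∖ {i}) ∪ {j} ∈ Δ, then F(Δ) admits a strong shelling order. -/
variable {α : Type*}

/-- Every face of a complex is contained in a facet. -/
theorem exists_isFacet_superset {Δ : Finset (Finset α)} {F : Finset α} (hF : F ∈ Δ) :
    ∃ G, F ⊆ G ∧ IsFacet Δ G := by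
  obtain ⟨G, hFG, hG⟩ := Δ.exists_le_maximal hF
  exact ⟨G, hFG, hG.prop, fun H hH hGH => hG.eq_of_le hH hGH⟩

/-- In a pure complex, a face with as many elements as some facet is a facet. -/
theorem isFacet_of_card_eq {Δ : Finset (Finset α)}
    (hpure : ∀ F G, IsFacet Δ F → IsFacet Δ G → F.card = G.card) {F G : Finset α}
    (hF : IsFacet Δ F) (hG : G ∈ Δ) (hcard : G.card = F.card) : IsFacet Δ G := by
  obtain ⟨H, hGH, hH⟩ := exists_isFacet_superset hG
  rwa [Finset.eq_of_subset_of_card_le hGH (by rw [hcard, hpure F H hF hH])]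

/-- A finite family of finite sets can be listed in decreasing colexicographic order. -/
theorem exists_list_colex_gt [LinearOrder α] (S : Finset (Finset α)) :
    ∃ L : List (Finset α), (∀ F, F ∈ L ↔ F ∈ S) ∧
      L.Pairwise fun F G => toColex G < toColex F := by
  refine ⟨((S.map toColex.toEmbedding).sort (· ≥ ·)).map ofColex, fun F => ?_, ?_⟩
  · simp
  · rw [List.pairwise_map]
    exact (Finset.sortedGT_sort _).pairwise

/-- If `F` precedes `G` in the reverse colexicographic order and both have the same cardinality,
then some element of `G \ F` can be exchanged for a larger element of `F \ G`. -/
theorem exists_lt_of_toColex_lt [LinearOrder α] {F G : Finset α}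
    (h : toColex G < toColex F) (hcard : G.card = F.card) :
    ∃ a ∈ G \ F, ∃ b ∈ F \ G, a < b := by
  obtain ⟨b, hbF, hbG, hb⟩ := Finset.Colex.toColex_lt_toColex_iff_exists_forall_lt.1 h
  have hne : (G \ F).Nonempty := by
    rw [← Finset.card_pos, Finset.card_sdiff_comm hcard, Finset.card_pos]
    exact ⟨b, Finset.mem_sdiff.2 ⟨hbF, hbG⟩⟩
  obtain ⟨a, ha⟩ := hne
  have ha' := Finset.mem_sdiff.1 ha
  exact ⟨a, ha, b, Finset.mem_sdiff.2 ⟨hbF, hbG⟩, hb a ha'.1 ha'.2⟩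

/-- every pure shifted complex on `[n]` (here modelled on `Fin n`) is
strongly shellable. Shifted: for every face `F`, every `i ∈ F` and every `j > i`,
the set `(F ∖ {i}) ∪ {j}` is also a face. -/
theorem stmt19 (n : ℕ) (Δ : Finset (Finset (Fin n))) (hΔ : IsComplex Δ)
    (hpure : ∀ F G, IsFacet Δ F → IsFacet Δ G → F.card = G.card)
    (hshift : ∀ F ∈ Δ, ∀ i ∈ F, ∀ j : Fin n, i < j → insert j (F.erase i) ∈ Δ) :
    StronglyShellable Δ := by
  classical
  obtain ⟨L, hmem, hL⟩ := exists_list_colex_gt (Δ.filter (IsFacet Δ))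
  have hfacet : ∀ F, F ∈ L ↔ IsFacet Δ F := fun F => by
    rw [hmem, Finset.mem_filter, and_iff_right_iff_imp]
    exact And.left
  refine ⟨L, hL.imp fun h => ?_, hfacet, fun i j hij => ?_⟩
  · rintro rfl
    exact h.false
  have hget := List.pairwise_iff_get.1 hL
  have hFi := (hfacet _).1 (L.get_mem i)
  have hFj := (hfacet _).1 (L.get_mem j)
  obtain ⟨a, ha, b, hb, hab⟩ := exists_lt_of_toColex_lt (hget i j hij) (hpure _ _ hFj hFi)
  rw [Finset.mem_sdiff] at ha hb
  have hb' : b ∉ (L.get j).erase a := fun h => hb.2 (Finset.mem_of_mem_erase h)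
  have hK : IsFacet Δ (insert b ((L.get j).erase a)) := by
    refine isFacet_of_card_eq hpure hFj (hshift _ hFj.1 a ha.1 b hab) ?_
    rw [Finset.card_insert_of_notMem hb', Finset.card_erase_add_one ha.1]
  have hlt : toColex (L.get j) < toColex (insert b ((L.get j).erase a)) := by
    conv_lhs => rw [← Finset.insert_erase ha.1]
    exact (Finset.Colex.insert_lt_insert (Finset.notMem_erase _ _) hb').2 hab
  obtain ⟨k, hk⟩ := List.get_of_mem ((hfacet _).2 hK)
  have hsdiff : L.get j \ L.get k = {a} := by
    ext x
    simp only [hk, Finset.mem_sdiff, Finset.mem_insert, Finset.mem_erase, Finset.mem_singleton]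
    grind
  refine ⟨k, ?_, ?_, ?_, ?_⟩
  · by_contra hkj
    rcases (not_lt.1 hkj).eq_or_lt with rfl | hjk
    · exact hlt.ne (congrArg toColex hk)
    · exact (hget j k hjk).asymm (hk ▸ hlt)
  · rw [hsdiff, Finset.card_singleton]
  · rw [hsdiff, Finset.singleton_subset_iff, Finset.mem_sdiff]
    exact ha
  · intro x hx
    simp only [hk, Finset.mem_sdiff, Finset.mem_insert, Finset.mem_erase] at hx
    grind
end
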